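/- arXiv:2603.26725 — 5 statements merged into one kernel-verified Lean document; each statement's English description precedes it below -/
import Mathlib

section
/- Correctness of the safety encoding with a forbidden atom: let V be a finite type, 𝓕 a finite set of rules over V, and F ⊆ V a forbidden set. Form the extended type W = V ⊕ Unit with distinguished atom ⊥ᶠ = Sum.inr (), and the extended rule set 𝓕' over W consisting of every rule of 𝓕 with all atoms mapped through Sum.inl, together with one rule ({Sum.inl f}, ⊥ᶠ) for each f ∈ F. Then for every A ⊆ V: (1) for all v ∈ V, Sum.inl v ∈ cl_{𝓕'}(Sum.inl '' A) if and only if v ∈ cl_𝓕(A); and (2) ⊥ᶠ ∈ cl_{𝓕'}(Sum.inl '' A) if and only if cl_𝓕(A) ∩ F ≠ ∅ (i.e., A is unsafe). -/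
/-- A set `C` is closed under the rule set `𝓕`: whenever the tail of a rule is
contained in `C`, its head is in `C`. -/
def Closed {V : Type*} (𝓕 : Finset (Finset V × V)) (C : Set V) : Prop :=
  ∀ r ∈ 𝓕, ↑r.1 ⊆ C → r.2 ∈ C

/-- The closure `cl_𝓕(A)`: the least `𝓕`-closed set containing `A`. -/
def cl {V : Type*} (𝓕 : Finset (Finset V × V)) (A : Set V) : Set V :=
  ⋂₀ {C : Set V | A ⊆ C ∧ Closed 𝓕 C}

/-- The extended rule set `𝓕'` over `W = V ⊕ Unit`: every rule of `𝓕` with all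
atoms mapped through `Sum.inl`, together with one rule `({Sum.inl f}, ⊥ᶠ)` for
each forbidden atom `f ∈ F`, where `⊥ᶠ = Sum.inr ()`. -/
def extRules {V : Type*} [DecidableEq V] (𝓕 : Finset (Finset V × V)) (F : Finset V) :
    Finset (Finset (V ⊕ Unit) × (V ⊕ Unit)) :=
  𝓕.image (fun r => (r.1.image Sum.inl, (Sum.inl r.2 : V ⊕ Unit))) ∪
    F.image (fun f => (({Sum.inl f} : Finset (V ⊕ Unit)), (Sum.inr () : V ⊕ Unit)))

theorem closed_cl_aux {V : Type*} (𝓕 : Finset (Finset V × V)) (A : Set V) :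
    Closed 𝓕 (cl 𝓕 A) := by
  intro r hr hs C hC
  exact hC.2 r hr (fun x hx => hs hx C hC)

theorem subset_cl_aux {V : Type*} (𝓕 : Finset (Finset V × V)) (A : Set V) :
    A ⊆ cl 𝓕 A := fun _ hx _ hC => hC.1 hx

theorem closed_ext_iff_aux {V : Type*} [DecidableEq V] (𝓕 : Finset (Finset V × V))
    (F : Finset V) (D : Set (V ⊕ Unit)) :
    Closed (extRules 𝓕 F) D ↔
      Closed 𝓕 (Sum.inl ⁻¹' D) ∧ ∀ f ∈ F, Sum.inl f ∈ D → Sum.inr () ∈ D := by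
  constructor
  · intro h
    refine ⟨fun r hr hs => ?_, fun f hf hD => ?_⟩
    · refine h (r.1.image Sum.inl, Sum.inl r.2)
        (Finset.mem_union_left _ (Finset.mem_image_of_mem _ hr)) ?_
      intro x hx
      obtain ⟨y, hy, rfl⟩ := Finset.mem_image.1 (Finset.mem_coe.1 hx)
      exact hs hy
    · refine h ({Sum.inl f}, Sum.inr ())
        (Finset.mem_union_right _ (Finset.mem_image.2 ⟨f, hf, rfl⟩)) ?_
      intro x hx
      have hx' : x = Sum.inl f := Finset.mem_singleton.1 (Finset.mem_coe.1 hx)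
      rw [hx']
      exact hD
  · rintro ⟨h1, h2⟩ r hr hs
    rcases Finset.mem_union.1 hr with hr | hr
    · obtain ⟨q, hq, rfl⟩ := Finset.mem_image.1 hr
      exact h1 q hq (fun y hy => hs (Finset.mem_coe.2 (Finset.mem_image_of_mem _ hy)))
    · obtain ⟨f, hf, rfl⟩ := Finset.mem_image.1 hr
      exact h2 f hf (hs (Finset.mem_coe.2 (Finset.mem_singleton_self _)))

/-- Correctness of the safety encoding with a forbidden atom: (1) the extended
program derives `Sum.inl v` exactly when the original program derives `v`, and
(2) it derives the forbidden atom `⊥ᶠ = Sum.inr ()` exactly when `A` is unsafe,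
i.e. `cl_𝓕(A) ∩ F ≠ ∅`. -/
theorem safety_encoding_correct {V : Type*} [Fintype V] [DecidableEq V]
    (𝓕 : Finset (Finset V × V)) (F : Finset V) :
    ∀ A : Set V,
      (∀ v : V,
        (Sum.inl v ∈ cl (extRules 𝓕 F) (Sum.inl '' A)) ↔ v ∈ cl 𝓕 A) ∧
      ((Sum.inr () ∈ cl (extRules 𝓕 F) (Sum.inl '' A)) ↔ cl 𝓕 A ∩ ↑F ≠ ∅) := by
  intro A
  have hE := (closed_ext_iff_aux 𝓕 F _).1 (closed_cl_aux (extRules 𝓕 F) (Sum.inl '' A))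
  have hback : ∀ v ∈ cl 𝓕 A, Sum.inl v ∈ cl (extRules 𝓕 F) (Sum.inl '' A) := fun v hv =>
    hv (Sum.inl ⁻¹' cl (extRules 𝓕 F) (Sum.inl '' A))
      ⟨fun a ha => subset_cl_aux (extRules 𝓕 F) (Sum.inl '' A) (Set.mem_image_of_mem _ ha), hE.1⟩
  let D : Set (V ⊕ Unit) :=
    {w | Sum.elim (fun v => v ∈ cl 𝓕 A) (fun _ => (cl 𝓕 A ∩ ↑F).Nonempty) w}
  have hD : cl (extRules 𝓕 F) (Sum.inl '' A) ⊆ D := by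
    intro w hw
    refine hw D ⟨?_, (closed_ext_iff_aux 𝓕 F D).2 ⟨closed_cl_aux 𝓕 A, ?_⟩⟩
    · rintro _ ⟨a, ha, rfl⟩
      exact subset_cl_aux 𝓕 A ha
    · intro f hf hfD
      exact ⟨f, hfD, hf⟩
  refine ⟨fun v => ⟨fun h => hD h, hback v⟩, fun h => ?_, fun h => ?_⟩
  · exact Set.nonempty_iff_ne_empty.1 (hD h)
  · obtain ⟨f, hf, hfF⟩ := Set.nonempty_iff_ne_empty.2 h
    exact hE.2 f hfF (hback f hf)
end

section
/- The minimal unsafe antichain equals the set of minimal Datalog witnesses for the forbidden atom: with V, 𝓕, F, the extended type W = V ⊕ Unit, forbidden atom ⊥ᶠ, and extended rule set 𝓕' as in the safety encoding, a finite set B ⊆ V satisfies B ∈ 𝓑(F) if and only if B is a minimal witness for the query (𝓕', ⊥ᶠ), i.e., ⊥ᶠ ∈ cl_{𝓕'}(Sum.inl '' B) and for every b ∈ B, ⊥ᶠ ∉ cl_{𝓕'}(Sum.inl '' (B \ {b})). -/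
/-- The forbidden atom is derivable from `A` iff the closure of `A` meets `F`. -/
theorem inr_mem_cl_ext_iff {V : Type*} [DecidableEq V]
    (𝓕 : Finset (Finset V × V)) (F : Finset V) (A : Set V) :
    Sum.inr () ∈ cl (extRules 𝓕 F) (Sum.inl '' A) ↔ cl 𝓕 A ∩ ↑F ≠ ∅ := by
  constructor
  · intro h hE
    -- the set `Sum.inl '' cl 𝓕 A` is closed and omits the forbidden atom
    have hmem := h (Sum.inl '' cl 𝓕 A) ⟨?_, ?_⟩
    · obtain ⟨x, -, hx⟩ := hmem
      cases hx
    · exact Set.image_mono (fun a ha C hC => hC.1 ha)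
    · intro r hr hsub
      rcases Finset.mem_union.1 hr with hr | hr
      · obtain ⟨q, hq, rfl⟩ := Finset.mem_image.1 hr
        refine ⟨q.2, ?_, rfl⟩
        intro C hC
        refine hC.2 q hq (fun x hx => ?_)
        obtain ⟨y, hy, hyx⟩ := hsub (Finset.mem_coe.2 (Finset.mem_image_of_mem Sum.inl hx))
        cases hyx
        exact hy C hC
      · obtain ⟨f, hf, rfl⟩ := Finset.mem_image.1 hr
        obtain ⟨y, hy, hyx⟩ := hsub (Finset.mem_coe.2 (Finset.mem_singleton_self (Sum.inl f)))
        cases hyx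
        exact absurd (show f ∈ cl 𝓕 A ∩ ↑F from ⟨hy, hf⟩) (by rw [hE]; exact id)
  · intro h C hC
    obtain ⟨f, hf, hfF⟩ := Set.nonempty_iff_ne_empty.2 h
    have hfC : f ∈ (Sum.inl ⁻¹' C : Set V) := by
      refine hf _ ⟨fun a ha => hC.1 ⟨a, ha, rfl⟩, fun r hr hsub => ?_⟩
      refine hC.2 (r.1.image Sum.inl, Sum.inl r.2)
        (Finset.mem_union_left _ (Finset.mem_image.2 ⟨r, hr, rfl⟩)) (fun x hx => ?_)
      obtain ⟨y, hy, rfl⟩ := Finset.mem_image.1 (Finset.mem_coe.1 hx)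
      exact hsub hy
    refine hC.2 ({Sum.inl f}, Sum.inr ())
      (Finset.mem_union_right _ (Finset.mem_image.2 ⟨f, hfF, rfl⟩)) (fun x hx => ?_)
    rw [Finset.mem_singleton.1 (Finset.mem_coe.1 hx)]
    exact hfC

/-- The minimal unsafe antichain equals the set of minimal Datalog witnesses for
the forbidden atom: `B ∈ 𝓑(F)` (i.e. `B` is not `F`-safe but `B \ {b}` is `F`-safe
for every `b ∈ B`) iff `⊥ᶠ ∈ cl_{𝓕'}(Sum.inl '' B)` and removing any `b ∈ B`
destroys the derivation of `⊥ᶠ`. -/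
theorem minimal_unsafe_antichain_eq_minimal_witnesses
    {V : Type*} [Fintype V] [DecidableEq V]
    (𝓕 : Finset (Finset V × V)) (F : Finset V) (B : Finset V) :
    ((cl 𝓕 ↑B ∩ ↑F ≠ ∅) ∧ ∀ b ∈ B, cl 𝓕 (↑B \ {b}) ∩ ↑F = ∅) ↔
    ((Sum.inr () ∈ cl (extRules 𝓕 F) (Sum.inl '' ↑B)) ∧
      ∀ b ∈ B, Sum.inr () ∉ cl (extRules 𝓕 F) (Sum.inl '' (↑B \ {b}))) := by
  simp only [inr_mem_cl_ext_iff, not_not, ne_eq]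
end

section
/- Indistinguishability lemma, tail-atom case: for every k ≥ 1 there exist a finite type V, two finite rule sets 𝓕⁻ ⊆ 𝓕⁺ over V differing in exactly one rule, a configuration A ⊆ V, a rule u = (S, v) with S.card = k and v ∉ ↑S, and an atom s ∈ S, such that: (i) the unique rule in 𝓕⁺ \ 𝓕⁻ has head s; (ii) for every atom b ≠ s, b ∈ cl_{𝓕⁺}(A) if and only if b ∈ cl_{𝓕⁻}(A); (iii) s ∈ cl_{𝓕⁺}(A) but s ∉ cl_{𝓕⁻}(A); and (iv) after inserting u, v ∈ cl_{𝓕⁺ ∪ {u}}(A) but v ∉ cl_{𝓕⁻ ∪ {u}}(A). Hence any procedure deciding whether the inserted rule u fires that does not inspect the tail atom s cannot be correct on both instances. -/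
/-- Indistinguishability lemma, tail-atom case: for every `k ≥ 1` there are a
finite type `V`, rule sets `𝓕⁻ ⊆ 𝓕⁺` differing in exactly one rule (whose head
is the tail atom `s`), a configuration `A`, and an inserted rule `u = (S, v)`
with `|S| = k`, `v ∉ S`, `s ∈ S`, such that the two instances agree on the
derivability of every atom other than `s`, disagree on `s`, and after inserting
`u` the head `v` is derivable in the `⁺`-instance but not in the `⁻`-instance. -/
theorem tail_atom_indistinguishability :
    ∀ k : ℕ, 1 ≤ k →
      ∃ (V : Type) (_ : Fintype V) (_ : DecidableEq V)
        (𝓕m 𝓕p : Finset (Finset V × V)) (A : Set V)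
        (S : Finset V) (v s : V) (r : Finset V × V),
        𝓕m ⊆ 𝓕p ∧ 𝓕p \ 𝓕m = {r} ∧ r.2 = s ∧
        S.card = k ∧ v ∉ S ∧ s ∈ S ∧
        (∀ b : V, b ≠ s → (b ∈ cl 𝓕p A ↔ b ∈ cl 𝓕m A)) ∧
        (s ∈ cl 𝓕p A ∧ s ∉ cl 𝓕m A) ∧
        (v ∈ cl (insert (S, v) 𝓕p) A ∧ v ∉ cl (insert (S, v) 𝓕m) A) := by
  intro k hk
  obtain ⟨n, rfl⟩ : ∃ n, k = n + 1 := ⟨k - 1, by omega⟩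
  let s : Option (Fin (n + 1)) := some 0
  let S : Finset (Option (Fin (n + 1))) := Finset.univ.map Function.Embedding.some
  let A : Set (Option (Fin (n + 1))) := {x | x ≠ none ∧ x ≠ s}
  have hsS : s ∈ S := by simp [S, s]
  have hvS : (none : Option (Fin (n + 1))) ∉ S := by simp [S]
  have hsA : s ∉ A := fun h => h.2 rfl
  have hvA : (none : Option (Fin (n + 1))) ∉ A := fun h => h.1 rfl
  refine ⟨Option (Fin (n + 1)), inferInstance, inferInstance, ∅, {(∅, s)}, A, S, none, s,
    (∅, s), by simp, by simp, rfl, by simp [S], hvS, hsS, ?_, ⟨?_, ?_⟩, ?_, ?_⟩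
  · intro b hb
    constructor
    · intro h C hC
      have h1 : b ∈ insert s C := by
        apply h
        refine ⟨fun x hx => Or.inr (hC.1 hx), ?_⟩
        intro r hr _
        rw [Finset.mem_singleton] at hr
        subst hr
        exact Or.inl rfl
      exact h1.resolve_left hb
    · intro h C hC
      exact h C ⟨hC.1, fun r hr => by simp at hr⟩
  · intro C hC
    exact hC.2 (∅, s) (by simp) (by simp)
  · intro h
    exact hsA (h A ⟨subset_rfl, fun r hr => by simp at hr⟩)
  · intro C hC
    have hs : s ∈ C := hC.2 (∅, s) (by simp) (by simp)
    refine hC.2 (S, none) (by simp) ?_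
    intro x hx
    by_cases hxs : x = s
    · rw [hxs]; exact hs
    · refine hC.1 ⟨?_, hxs⟩
      rintro rfl
      exact hvS hx
  · intro h
    refine hvA (h A ⟨subset_rfl, ?_⟩)
    intro r hr hsub
    have hr' : r = (S, none) := by simpa using hr
    subst hr'
    exact absurd (hsub hsS) hsA
end

section
/- Active insertion of a fresh-headed rule changes the closure by exactly one atom: let V be a finite type, 𝓕 a finite rule set over V, A ⊆ V, and u = (S, v) a rule such that v ∉ A, v ∉ ↑S, v does not occur in the tail of any rule of 𝓕, v is not the head of any rule of 𝓕, and ↑S ⊆ cl_𝓕(A). Then cl_{𝓕 ∪ {u}}(A) = cl_𝓕(A) ∪ {v}. (This is the semantic content of the locality-gap upper bound: the dependency cone of such an insertion is the single atom v.) -/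
/-- Active insertion of a fresh-headed rule changes the closure by exactly one
atom: if `u = (S, v)` has a fresh head `v` (not in `A`, not in `S`, occurring in
no tail and no head of `𝓕`) and its preconditions are satisfied
(`↑S ⊆ cl_𝓕(A)`), then `cl_{𝓕 ∪ {u}}(A) = cl_𝓕(A) ∪ {v}`. -/
theorem active_insertion_dependency_cone {V : Type*} [Fintype V] [DecidableEq V]
    (𝓕 : Finset (Finset V × V)) (A : Set V) (S : Finset V) (v : V)
    (hvA : v ∉ A) (hvS : v ∉ S)
    (htail : ∀ r ∈ 𝓕, v ∉ r.1) (hhead : ∀ r ∈ 𝓕, r.2 ≠ v)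
    (hS : ↑S ⊆ cl 𝓕 A) :
    cl (insert (S, v) 𝓕) A = cl 𝓕 A ∪ {v} := by
  have hmono : cl 𝓕 A ⊆ cl (insert (S, v) 𝓕) A := by
    intro x hx C hC
    exact hx C ⟨hC.1, fun r hr => hC.2 r (Finset.mem_insert_of_mem hr)⟩
  apply Set.Subset.antisymm
  · intro x hx
    refine hx (cl 𝓕 A ∪ {v}) ⟨fun a ha => Or.inl fun C hC => hC.1 ha, ?_⟩
    intro r hr hsub
    rcases Finset.mem_insert.mp hr with rfl | hr2
    · exact Or.inr rfl
    · refine Or.inl fun C hC => hC.2 r hr2 fun y hy => ?_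
      rcases hsub hy with h | h
      · exact h C hC
      · have h' : y = v := h
        subst h'
        exact absurd hy (htail r hr2)
  · rintro x (hx | hx)
    · exact hmono hx
    · have h' : x = v := hx
      subst h'
      intro C hC
      exact hC.2 (S, x) (Finset.mem_insert_self _ _) fun y hy => hmono (hS hy) C hC
end

section
/- Lazy insertion of a rule with unsatisfied preconditions leaves the closure unchanged: let V be a finite type, 𝓕 a finite rule set over V, A ⊆ V, and u = (S, v) a rule such that v ∉ ↑S, v does not occur in the tail of any rule of 𝓕, and ↑S ⊄ cl_𝓕(A). Then cl_{𝓕 ∪ {u}}(A) = cl_𝓕(A). (This is the semantic content of the O(|S|)-cost lazy-insertion case of incremental maintenance: a rule whose tail is not satisfied and whose head feeds no other rule can never fire.) -/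
/-- Lazy insertion of a rule with unsatisfied preconditions leaves the closure
unchanged: if `u = (S, v)` satisfies `v ∉ S`, `v` occurs in no tail of `𝓕`, and
`↑S ⊄ cl_𝓕(A)`, then `cl_{𝓕 ∪ {u}}(A) = cl_𝓕(A)`. -/
theorem lazy_insertion_no_change {V : Type*} [Fintype V] [DecidableEq V]
    (𝓕 : Finset (Finset V × V)) (A : Set V) (S : Finset V) (v : V)
    (hvS : v ∉ S) (htail : ∀ r ∈ 𝓕, v ∉ r.1)
    (hS : ¬ (↑S ⊆ cl 𝓕 A)) :
    cl (insert (S, v) 𝓕) A = cl 𝓕 A := by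
  apply Set.Subset.antisymm
  · apply Set.sInter_subset_of_mem
    refine ⟨fun x hx C hC => hC.1 hx, ?_⟩
    intro r hr hsub
    rcases Finset.mem_insert.1 hr with h | h
    · subst h
      exact absurd hsub hS
    · intro C hC
      exact hC.2 r h (fun x hx => hsub hx C hC)
  · intro x hx C hC
    exact hx C ⟨hC.1, fun r hr => hC.2 r (Finset.mem_insert_of_mem hr)⟩
end
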